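/- Let n = 2^m with m ≥ 4, and put K = (n!/(6·((n/4)!)^4)) · ∏_{t=1}^{m−2} (D_t^{W_{t+1}} − D_t·W_{t+1})^{E_t}, where D_t = 2·(binom(2^t, 2^{t−1})/2)^{2^{m−t}}, W_i = 2^{2^{m−i}−1} for i = 1,…,m−1, and E_t = ∏_{i=t+2}^{m−1} W_i (with E_{m−2} = 1 as the empty product). Then the number of equivalence classes of 1-perfect binary codes of length n−1 under the action of the isometry group of F^{n−1} is at least K/((n−1)!·2^{n−5}). -/

import Mathlib

open Finset Pointwise

abbrev Word (n : ℕ) := Fin n → ZMod 2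

def FEv (n : ℕ) : Set (Word n) := {x | Even (hammingNorm x)}

def FOd (n : ℕ) : Set (Word n) := {x | ¬ Even (hammingNorm x)}

def nbr {n : ℕ} (S : Set (Word n)) : Set (Word n) := {y | ∃ x ∈ S, hammingDist y x = 1}

def theta {n : ℕ} (G : Set (Word n)) : Set (Word n) :=
  {x | Even (hammingNorm x) ∧ nbr {x} ⊆ nbr G}

def ExtPerfect {n : ℕ} (C : Set (Word n)) : Prop :=
  C ⊆ FEv n ∧ (∀ x ∈ C, ∀ y ∈ C, x ≠ y → Disjoint (nbr {x}) (nbr {y})) ∧ nbr C = FOd n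

def IsIsometry {n : ℕ} (g : Word n → Word n) : Prop :=
  Function.Bijective g ∧ ∀ x y, hammingDist (g x) (g y) = hammingDist x y

def embWord (m t : ℕ) (v : Word (2 ^ (m - t))) : Word (2 ^ m) := fun i =>
  if h : (i : ℕ) < 2 ^ (m - t) then v ⟨i, h⟩
  else if h2 : (i : ℕ) < 2 * 2 ^ (m - t) then v ⟨(i : ℕ) - 2 ^ (m - t), by omega⟩
  else 0

def Vt (m t : ℕ) : Set (Word (2 ^ m)) :=
  {x | ∃ v : Word (2 ^ (m - t)), Even (hammingNorm v) ∧ x = embWord m t v}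

def At (m : ℕ) : ℕ → Set (Word (2 ^ m))
  | 0 => {0}
  | 1 => Vt m 1
  | t + 2 => Vt m (t + 2) + At m (t + 1)

def IsComp (m t : ℕ) (G : Set (Word (2 ^ m))) : Prop :=
  G ⊆ FEv (2 ^ m) ∧ G.ncard = (At m t).ncard ∧ nbr G = nbr (At m t)

def IsMuComp (m t : ℕ) (μ : Word (2 ^ m)) (M : Set (Word (2 ^ m))) : Prop :=
  (∀ i : Fin (2 ^ m), 2 ^ (m - t) ≤ (i : ℕ) → μ i = 0) ∧
  ∃ G, IsComp m t G ∧ M = (fun x => μ + x) '' G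

def arrEntry (m t : ℕ) (x : Word (2 ^ m)) (i : Fin (2 ^ t)) (j : Fin (2 ^ (m - t))) : ZMod 2 :=
  x ⟨((i : ℕ) * 2 ^ (m - t) + (j : ℕ)) % 2 ^ m, Nat.mod_lt _ (Nat.two_pow_pos m)⟩

def pchk (m t : ℕ) (x : Word (2 ^ m)) : Word (2 ^ (m - t)) :=
  fun j => ∑ i : Fin (2 ^ t), arrEntry m t x i j

def Bt (m : ℕ) : ℕ → Set (Word (2 ^ m))
  | 0 => Vt m 1
  | 1 => Vt m 1
  | t + 2 => Vt m (t + 2) + theta (At m (t + 1))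

/-- A 1-perfect binary code of length N: radius-1 balls around codewords partition F^N. -/
def Perfect1 {N : ℕ} (C : Set (Word N)) : Prop :=
  ∀ y : Word N, ∃! x, x ∈ C ∧ hammingDist x y ≤ 1

/-- |𝒟^t| for t < m-1. -/
def Dfac (m t : ℕ) : ℕ := 2 * (Nat.choose (2 ^ t) (2 ^ (t - 1)) / 2) ^ 2 ^ (m - t)

/-- |V^i| = 2^{2^{m-i}-1}. -/
def Wfac (m i : ℕ) : ℕ := 2 ^ (2 ^ (m - i) - 1)

/-- Equivalence of 1-perfect codes: C ~ C' iff C' = g(C) for some isometry g of F^N. -/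
def codeEquiv (N : ℕ) (C C' : {C : Set (Word N) // Perfect1 C}) : Prop :=
  ∃ g : Word N → Word N, IsIsometry g ∧ (C' : Set (Word N)) = g '' (C : Set (Word N))

namespace PerfectCode

set_option linter.unusedSectionVars false

section Components

variable {I J K : Type} [Fintype I] [Fintype J] [Fintype K]
  [DecidableEq I] [DecidableEq J] [DecidableEq K]

/-- The sums of the coordinates of `x` over the fibers of `κ`. -/
def colSum (κ : I → J) (x : I → ZMod 2) (j : J) : ZMod 2 := ∑ i with κ i = j, x i

/-- Words with column sums `v` forming a perfect code for the words whose column sums are at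
distance one from `v`. -/
def IsComponent (κ : I → J) (v : J → ZMod 2) (G : Set (I → ZMod 2)) : Prop :=
  (∀ x ∈ G, colSum κ x = v) ∧
    ∀ y j, colSum κ y = v + Pi.single j 1 → ∃! i, y + Pi.single i 1 ∈ G

lemma zmod_two_cases (a : ZMod 2) : a = 0 ∨ a = 1 := by
  revert a; decide

lemma sum_zmod_two {M : Type*} [AddCommMonoid M] (f : ZMod 2 → M) : ∑ b, f b = f 0 + f 1 :=
  Fin.sum_univ_two f

lemma word_add_self {A : Type*} (x : A → ZMod 2) : x + x = 0 :=
  funext fun _ => CharTwo.add_self_eq_zero _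

lemma colSum_add (κ : I → J) (x y : I → ZMod 2) :
    colSum κ (x + y) = colSum κ x + colSum κ y := by
  funext j
  simp [colSum, Finset.sum_add_distrib]

lemma colSum_single (κ : I → J) (i : I) :
    colSum κ (Pi.single i 1) = Pi.single (κ i) 1 := by
  funext j
  simp only [colSum, Pi.single_apply]
  simp [eq_comm]

lemma sum_mul_colSum (κ : I → J) (a : J → ZMod 2) (x : I → ZMod 2) :
    ∑ j, a j * colSum κ x j = ∑ i, a (κ i) * x i := by
  rw [← Finset.sum_fiberwise (s := univ) (g := κ)]
  refine Finset.sum_congr rfl fun j _ => ?_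
  rw [colSum, Finset.mul_sum]
  refine Finset.sum_congr rfl fun i hi => ?_
  rw [(Finset.mem_filter.1 hi).2]

lemma colSum_colSum (κ : I → J) (l : J → K) (x : I → ZMod 2) :
    colSum l (colSum κ x) = colSum (l ∘ κ) x := by
  funext k
  have h := sum_mul_colSum κ (fun j => if l j = k then 1 else 0) x
  simpa [colSum, Finset.sum_filter] using h

lemma exists_colSum_eq (κ : I → J) (hκ : Function.Surjective κ) (v : J → ZMod 2) :
    ∃ x, colSum κ x = v := by
  refine ⟨fun i => if i = Function.surjInv hκ (κ i) then v (κ i) else 0, ?_⟩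
  funext j
  rw [colSum, Finset.sum_eq_single (Function.surjInv hκ j)]
  · simp [Function.surjInv_eq]
  · intro i hi hne
    rw [(Finset.mem_filter.1 hi).2, if_neg hne]
  · simp [Function.surjInv_eq]

lemma IsComponent.nonempty [Nonempty J] {κ : I → J} {v : J → ZMod 2} {G : Set (I → ZMod 2)}
    (hG : IsComponent κ v G) (hκ : Function.Surjective κ) : G.Nonempty := by
  obtain ⟨j⟩ := ‹Nonempty J›
  obtain ⟨y, hy⟩ := exists_colSum_eq κ hκ (v + Pi.single j 1)
  obtain ⟨i, hi, -⟩ := hG.2 y j hy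
  exact ⟨_, hi⟩

/-- Concatenation of components. -/
lemma IsComponent.iUnion {κ : I → J} {l : J → K} {v : K → ZMod 2} {T : Set (J → ZMod 2)}
    (hT : IsComponent l v T) {F : T → Set (I → ZMod 2)} (hF : ∀ w : T, IsComponent κ w (F w)) :
    IsComponent (l ∘ κ) v (⋃ w, F w) := by
  constructor
  · intro x hx
    obtain ⟨w, hw⟩ := Set.mem_iUnion.1 hx
    rw [← colSum_colSum, (hF w).1 x hw, hT.1 _ w.2]
  · intro y k hy
    rw [← colSum_colSum] at hy
    obtain ⟨j, hj, hju⟩ := hT.2 _ k hy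
    obtain ⟨i, hi, hiu⟩ := (hF ⟨_, hj⟩).2 y j (by
      rw [add_assoc, word_add_self, add_zero])
    refine ⟨i, Set.mem_iUnion.2 ⟨_, hi⟩, fun i' hi' => ?_⟩
    obtain ⟨w, hw⟩ := Set.mem_iUnion.1 hi'
    have h1 := (hF w).1 _ hw
    rw [colSum_add, colSum_single] at h1
    have h2 : κ i' = j := hju _ (by simp only [h1]; exact w.2)
    refine hiu i' ?_
    have h3 : w = ⟨_, hj⟩ := Subtype.ext (by rw [← h1, h2])
    rw [← h3]
    exact hw

lemma isComponent_of_bijective {κ : I → J} (hκ : Function.Bijective κ) (w : J → ZMod 2) :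
    IsComponent κ w {x | colSum κ x = w} := by
  refine ⟨fun x hx => hx, fun y j hy => ?_⟩
  obtain ⟨i, rfl⟩ := hκ.2 j
  refine ⟨i, ?_, fun i' hi' => ?_⟩
  · simp only [Set.mem_ofPred_eq, colSum_add, colSum_single, hy]
    rw [add_assoc, word_add_self, add_zero]
  · simp only [Set.mem_ofPred_eq, colSum_add, colSum_single, hy] at hi'
    rw [add_assoc, add_eq_left] at hi'
    have := congrFun hi' (κ i')
    by_contra hne
    simp [hκ.1.eq_iff, hne] at this

/-- The words over the pairs of half-columns which combine components into larger ones. -/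
def outer (v : J → ZMod 2) (p : ZMod 2) : Set (J × ZMod 2 → ZMod 2) :=
  {w | colSum Prod.fst w = v ∧ ∑ j, w (j, 1) = p}

lemma colSum_fst (w : J × ZMod 2 → ZMod 2) (j : J) :
    colSum Prod.fst w j = w (j, 0) + w (j, 1) := by
  rw [colSum, Finset.sum_filter, Fintype.sum_prod_type]
  simp [sum_zmod_two, Finset.sum_add_distrib]

lemma isComponent_outer (v : J → ZMod 2) (p : ZMod 2) :
    IsComponent Prod.fst v (outer v p) := by
  refine ⟨fun w hw => hw.1, fun w j hw => ?_⟩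
  have key : ∀ i b, w + Pi.single (i, b) 1 ∈ outer v p ↔ i = j ∧ b = p + ∑ j, w (j, 1) := by
    intro i b
    have h2 : ∑ k, (w + Pi.single (i, b) 1 : J × ZMod 2 → ZMod 2) (k, 1) = ∑ k, w (k, 1) + b := by
      simp only [Pi.add_apply, Finset.sum_add_distrib, Pi.single_apply, Prod.mk.injEq]
      congr 1
      rcases zmod_two_cases b with rfl | rfl <;> simp
    have h3 : v + Pi.single j 1 + Pi.single i 1 = v ↔ i = j := by
      rw [add_assoc, add_eq_left]
      constructor
      · intro h
        have := congrFun h i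
        by_contra hne
        simp [hne] at this
      · rintro rfl
        exact word_add_self _
    rw [outer, Set.mem_ofPred_eq, h2, colSum_add, colSum_single, hw]
    refine and_congr h3 ⟨?_, ?_⟩
    · rintro rfl
      rw [add_comm, ← add_assoc, CharTwo.add_self_eq_zero, zero_add]
    · rintro rfl
      rw [add_comm p, ← add_assoc, CharTwo.add_self_eq_zero, zero_add]
  refine ⟨(j, p + ∑ j, w (j, 1)), (key _ _).2 ⟨rfl, rfl⟩, ?_⟩
  rintro ⟨i, b⟩ h
  obtain ⟨rfl, rfl⟩ := (key _ _).1 h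
  rfl

/-- An element of `outer v p` is determined by its second half. -/
def outerEquiv (v : J → ZMod 2) (p : ZMod 2) : outer v p ≃ {u : J → ZMod 2 // ∑ j, u j = p} where
  toFun w := ⟨fun j => w.1 (j, 1), w.2.2⟩
  invFun u := ⟨fun jb => u.1 jb.1 + (1 + jb.2) * v jb.1, by
    constructor
    · funext j
      rw [colSum_fst]
      simp only [add_zero, one_mul, CharTwo.add_self_eq_zero, zero_mul]
      rw [add_right_comm, CharTwo.add_self_eq_zero, zero_add]
    · simpa [CharTwo.add_self_eq_zero] using u.2⟩
  left_inv w := by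
    ext ⟨j, b⟩
    obtain ⟨w, hw, -⟩ := w
    have := congrFun hw j
    rw [colSum_fst] at this
    rcases zmod_two_cases b with rfl | rfl
    · simp only [← this, add_zero, one_mul]
      rw [add_comm (w (j, 0)), ← add_assoc, CharTwo.add_self_eq_zero, zero_add]
    · simp [CharTwo.add_self_eq_zero]
  right_inv u := by
    ext j
    simp [CharTwo.add_self_eq_zero]

/-- A word of given parity is determined by its coordinates other than `j₀`. -/
def sumEqEquiv (j₀ : J) (p : ZMod 2) :
    {u : J → ZMod 2 // ∑ j, u j = p} ≃ ({j // j ≠ j₀} → ZMod 2) where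
  toFun u j := u.1 j
  invFun f := ⟨fun j => if h : j = j₀ then p + ∑ i, f i else f ⟨j, h⟩, by
    rw [Fintype.sum_eq_add_sum_subtype_ne _ j₀, dif_pos rfl]
    have : ∀ i : {j // j ≠ j₀}, (if h : (i : J) = j₀ then p + ∑ i, f i else f ⟨i, h⟩) = f i :=
      fun i => dif_neg i.2
    simp only [this]
    rw [add_assoc, CharTwo.add_self_eq_zero, add_zero]⟩
  left_inv u := by
    ext j
    by_cases h : j = j₀
    · subst h
      have := u.2
      rw [Fintype.sum_eq_add_sum_subtype_ne _ j] at this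
      simp only [dif_pos]
      refine (congrArg (· + _) this.symm).trans ?_
      simp only [add_assoc, CharTwo.add_self_eq_zero, add_zero]
    · simp [h]
  right_inv f := by
    funext j
    exact dif_neg j.2

lemma card_fun_ne (j₀ : J) :
    Nat.card ({j // j ≠ j₀} → ZMod 2) = 2 ^ (Fintype.card J - 1) := by
  simp [Nat.card_eq_fintype_card, Fintype.card_subtype_compl]

lemma card_outer [Nonempty J] (v : J → ZMod 2) (p : ZMod 2) :
    Nat.card (outer v p) = 2 ^ (Fintype.card J - 1) := by
  obtain ⟨j₀⟩ := ‹Nonempty J›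
  rw [Nat.card_congr ((outerEquiv v p).trans (sumEqEquiv j₀ p)), card_fun_ne]

end Components

section Good

variable {I J : Type} [Fintype I] [Fintype J] [DecidableEq I] [DecidableEq J]

/-- A component at level `t` whose only affine checks are generated by the columns and by `h`,
together with the translations preserving it. -/
structure Good (t : ℕ) (κ : I → J) (v : J → ZMod 2) (h : I → ZMod 2) (p : ZMod 2)
    (G : Set (I → ZMod 2)) : Prop where
  component : IsComponent κ v G
  check : ∀ x ∈ G, ∑ i, h i * x i = p
  dual : ∀ (g : I → ZMod 2) (q : ZMod 2), (∀ x ∈ G, ∑ i, g i * x i = q) →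
    ∃ (c : ZMod 2) (a : J → ZMod 2), ∀ i, g i = c * h i + a (κ i)
  flip : ∀ a : J → ZMod 2, 2 ≤ t ∨ ∑ j, a j = 0 → ∀ x ∈ G, x + a ∘ κ ∈ G
  flip_split : 3 ≤ t → ∀ a : J × ZMod 2 → ZMod 2, ∀ x ∈ G, x + a ∘ (fun i => (κ i, h i)) ∈ G

lemma add_fst_mem_outer {v : J → ZMod 2} {p : ZMod 2} {w : J × ZMod 2 → ZMod 2}
    (hw : w ∈ outer v p) {a : J → ZMod 2} (ha : ∑ j, a j = 0) : w + a ∘ Prod.fst ∈ outer v p := by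
  constructor
  · rw [← hw.1]
    funext j
    simp only [colSum_fst, Pi.add_apply, Function.comp_apply]
    rw [add_add_add_comm, CharTwo.add_self_eq_zero, add_zero]
  · simp [Finset.sum_add_distrib, ha, hw.2]

lemma outer_nonempty [Nonempty J] (v : J → ZMod 2) (p : ZMod 2) : (outer v p).Nonempty := by
  have h := card_outer v p
  have : 0 < Nat.card (outer v p) := by rw [h]; positivity
  exact Set.nonempty_coe_sort.1 (Nat.card_pos_iff.1 this).1

lemma outer_dual [Nonempty J] {v : J → ZMod 2} {p q : ZMod 2} {a : J × ZMod 2 → ZMod 2}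
    (h : ∀ w ∈ outer v p, ∑ jb, a jb * w jb = q) :
    ∃ c, ∀ j b, a (j, b) = c * b + a (j, 0) := by
  obtain ⟨j₀⟩ := ‹Nonempty J›
  have : Nonempty J := ⟨j₀⟩
  obtain ⟨w, hw⟩ := outer_nonempty v p
  have key : ∀ j, a (j, 0) + a (j, 1) = a (j₀, 0) + a (j₀, 1) := by
    intro j
    have hs : ∑ k, (Pi.single j 1 + Pi.single j₀ 1 : J → ZMod 2) k = 0 := by
      simp [Finset.sum_add_distrib, CharTwo.add_self_eq_zero]
    have h1 := h _ (add_fst_mem_outer hw hs)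
    simp only [Pi.add_apply, mul_add, Finset.sum_add_distrib, h w hw, add_eq_left,
      Function.comp_apply] at h1
    have h2 := sum_mul_colSum Prod.fst (Pi.single j 1 + Pi.single j₀ 1 : J → ZMod 2) a
    simp only [Pi.add_apply, add_mul, Finset.sum_add_distrib] at h2
    simp only [mul_comm (a _)] at h1
    rw [h1] at h2
    simp only [Pi.single_apply, ite_mul, one_mul, zero_mul, Finset.sum_ite_eq', Finset.mem_univ,
      if_true, colSum_fst] at h2
    exact CharTwo.add_eq_zero.1 h2
  refine ⟨a (j₀, 0) + a (j₀, 1), fun j b => ?_⟩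
  rw [← key j]
  rcases zmod_two_cases b with rfl | rfl
  · simp
  · rw [mul_one, add_right_comm, CharTwo.add_self_eq_zero, zero_add]

lemma sum_snd_mul (w : J × ZMod 2 → ZMod 2) : ∑ jb, jb.2 * w jb = ∑ j, w (j, 1) := by
  rw [Fintype.sum_prod_type]
  simp [sum_zmod_two]

lemma colSum_comp_of_bijective {κ : I → J} (hκ : Function.Bijective κ) (a : J → ZMod 2) :
    colSum κ (a ∘ κ) = a := by
  funext j
  obtain ⟨i, rfl⟩ := hκ.2 j
  simp [colSum, hκ.1.eq_iff, Finset.filter_eq']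

lemma good_one [Nonempty J] {κ : I → J} {h : I → ZMod 2}
    (hb : Function.Bijective fun i => (κ i, h i)) (v : J → ZMod 2) (p : ZMod 2) :
    Good 1 κ v h p (⋃ w : outer v p, {x | colSum (fun i => (κ i, h i)) x = w}) where
  component := (isComponent_outer v p).iUnion fun w => isComponent_of_bijective hb w
  check x hx := by
    obtain ⟨w, hw⟩ := Set.mem_iUnion.1 hx
    have h1 := sum_mul_colSum (fun i => (κ i, h i)) Prod.snd x
    rw [← h1, hw, sum_snd_mul, w.2.2]
  dual g q hg := by
    obtain ⟨a, ha⟩ : ∃ a : J × ZMod 2 → ZMod 2, ∀ i, a (κ i, h i) = g i :=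
      ⟨fun jb => g ((Equiv.ofBijective _ hb).symm jb), fun i =>
        congrArg g ((Equiv.ofBijective _ hb).symm_apply_apply i)⟩
    obtain ⟨c, hc⟩ := outer_dual (v := v) (p := p) (a := a) (q := q) fun w hw => by
      obtain ⟨x, hx⟩ := exists_colSum_eq _ hb.2 w
      rw [← hg x (Set.mem_iUnion.2 ⟨⟨w, hw⟩, hx⟩), ← hx, sum_mul_colSum]
      simp only [ha]
    exact ⟨c, fun j => a (j, 0), fun i => by rw [← ha, hc]⟩
  flip a ha x hx := by
    obtain ⟨w, hw⟩ := Set.mem_iUnion.1 hx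
    refine Set.mem_iUnion.2 ⟨⟨_, add_fst_mem_outer w.2 (ha.resolve_left (by norm_num))⟩, ?_⟩
    have : colSum (fun i => (κ i, h i)) (a ∘ κ) = a ∘ Prod.fst :=
      colSum_comp_of_bijective hb (a ∘ Prod.fst)
    simp only [Set.mem_ofPred_eq, colSum_add, this]
    rw [hw]
  flip_split ht := by omega

lemma Good.iUnion [Nonempty J] {t : ℕ} {κ : I → J} {h : I → ZMod 2} {v : J → ZMod 2}
    {p : ZMod 2} {hs : outer v p → I → ZMod 2} {ps : outer v p → ZMod 2}
    {F : outer v p → Set (I → ZMod 2)}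
    (hF : ∀ w : outer v p, Good t (fun i => (κ i, h i)) w (hs w) (ps w) (F w))
    {b : J × ZMod 2 → I} (hb : ∀ jb, (κ (b jb), h (b jb)) = jb) (hsb : ∀ w jb, hs w (b jb) = 0)
    (hgen : ¬ ∃ h₀ q, ∃ a : J × ZMod 2 → ZMod 2,
      ∀ w, hs w = h₀ ∧ ps w = q + ∑ jb, a jb * w.1 jb) :
    Good (t + 1) κ v h p (⋃ w, F w) where
  component := (isComponent_outer v p).iUnion fun w => (hF w).component
  check x hx := by
    obtain ⟨w, hw⟩ := Set.mem_iUnion.1 hx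
    have h1 := sum_mul_colSum (fun i => (κ i, h i)) Prod.snd x
    rw [← h1, (hF w).component.1 x hw, sum_snd_mul, w.2.2]
  dual g q hg := by
    have hne : ∀ w, (F w).Nonempty := fun w =>
      (hF w).component.nonempty fun jb => ⟨b jb, hb jb⟩
    have hg' : ∀ w, ∀ x ∈ F w, ∑ i, g i * x i = q := fun w x hx =>
      hg x (Set.mem_iUnion.2 ⟨w, hx⟩)
    choose c a hca using fun w => (hF w).dual g q (hg' w)
    have hab : ∀ w jb, a w jb = g (b jb) := fun w jb => by
      rw [hca w, hsb, mul_zero, zero_add, hb]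
    by_cases h0 : ∃ w, c w = 0
    · obtain ⟨w₀, hw₀⟩ := h0
      have hga : ∀ i, g i = a w₀ (κ i, h i) := fun i => by rw [hca w₀, hw₀, zero_mul, zero_add]
      obtain ⟨d, hd⟩ := outer_dual (v := v) (p := p) (a := a w₀) (q := q) fun w hw => by
        obtain ⟨x, hx⟩ := hne ⟨w, hw⟩
        have hxw : _ = w := (hF ⟨w, hw⟩).component.1 x hx
        rw [← hg' _ x hx, ← hxw, sum_mul_colSum]
        simp only [hga]
      exact ⟨d, fun j => a w₀ (j, 0), fun i => by rw [hga, hd]⟩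
    · refine absurd ⟨fun i => g i + g (b (κ i, h i)), q, fun jb => g (b jb), fun w => ?_⟩ hgen
      have hc : c w = 1 := (zmod_two_cases _).resolve_left fun h => h0 ⟨w, h⟩
      have hh : ∀ i, hs w i = g i + g (b (κ i, h i)) := fun i => by
        rw [← hab w, hca w i, hc, one_mul, add_assoc, CharTwo.add_self_eq_zero, add_zero]
      refine ⟨funext hh, ?_⟩
      obtain ⟨x, hx⟩ := hne w
      rw [← (hF w).check x hx, ← hg' w x hx, ← (hF w).component.1 x hx, sum_mul_colSum,
        ← Finset.sum_add_distrib]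
      exact Finset.sum_congr rfl fun i _ => by rw [hh, add_mul]
  flip a _ x hx := by
    obtain ⟨w, hw⟩ := Set.mem_iUnion.1 hx
    refine Set.mem_iUnion.2 ⟨w, (hF w).flip (a ∘ Prod.fst) (Or.inr ?_) x hw⟩
    rw [Fintype.sum_prod_type]
    simp only [Function.comp_apply, sum_zmod_two, CharTwo.add_self_eq_zero, Finset.sum_const_zero]
  flip_split ht a x hx := by
    obtain ⟨w, hw⟩ := Set.mem_iUnion.1 hx
    exact Set.mem_iUnion.2 ⟨w, (hF w).flip a (Or.inl (by omega)) x hw⟩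

lemma Good.type_unique {t : ℕ} {κ : I → J} {h h' : I → ZMod 2} {v : J → ZMod 2} {p p' : ZMod 2}
    {G : Set (I → ZMod 2)} (hG : Good t κ v h p G) (hG' : Good t κ v h' p' G) (hne : G.Nonempty)
    {b : J → I} (hb : ∀ j, κ (b j) = j) (h0 : ∀ j, h (b j) = 0) (h0' : ∀ j, h' (b j) = 0)
    (hh' : h' ≠ 0) : h = h' ∧ p = p' := by
  obtain ⟨c, a, hca⟩ := hG.dual h' p' hG'.check
  have ha : ∀ j, a j = 0 := fun j => by
    have := hca (b j)
    rwa [h0, h0', mul_zero, zero_add, hb, eq_comm] at this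
  have heq : h = h' := by
    rcases zmod_two_cases c with rfl | rfl
    · exact absurd (funext fun i => by rw [hca, ha]; simp) hh'
    · exact funext fun i => by rw [hca, ha]; simp
  obtain ⟨x, hx⟩ := hne
  exact ⟨heq, by rw [← hG.check x hx, ← hG'.check x hx, heq]⟩

end Good

section Counting

variable {I J : Type} [Fintype I] [Fintype J] [DecidableEq I] [DecidableEq J]

/-- The number of ways to halve `k` columns of height `2 ^ t` and to choose a parity. -/
def splitCount (t k : ℕ) : ℕ := 2 * (Nat.choose (2 ^ t) (2 ^ (t - 1)) / 2) ^ k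

/-- A lower bound for the number of good components with `k` columns at level `s + 1`. -/
def goodCount : ℕ → ℕ → ℕ
  | 0, _ => 1
  | s + 1, k => (splitCount (s + 1) (2 * k) ^ 2 ^ (k - 1) -
      splitCount (s + 1) (2 * k) * 2 ^ (k - 1)) * goodCount s (2 * k) ^ 2 ^ (k - 1)

/-- A choice of `r` nonzero positions in each of the columns indexed by `J`. -/
abbrev Halving (J : Type) (r : ℕ) : Type := J → {A : Finset (Fin (2 * r - 1)) // A.card = r}

/-- The indicator word of a halving. -/
def Halving.word {r : ℕ} (e : I ≃ J × Option (Fin (2 * r - 1))) (A : Halving J r) (i : I) :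
    ZMod 2 :=
  (e i).2.elim 0 fun l => if l ∈ (A (e i).1).1 then 1 else 0

lemma Halving.word_symm_some {r : ℕ} (e : I ≃ J × Option (Fin (2 * r - 1))) (A : Halving J r)
    (j : J) (l : Fin (2 * r - 1)) :
    A.word e (e.symm (j, some l)) = if l ∈ (A j).1 then 1 else 0 := by
  simp [Halving.word]

lemma Halving.word_symm_none {r : ℕ} (e : I ≃ J × Option (Fin (2 * r - 1))) (A : Halving J r)
    (j : J) : A.word e (e.symm (j, none)) = 0 := by
  simp [Halving.word]

lemma Halving.word_injective {r : ℕ} (e : I ≃ J × Option (Fin (2 * r - 1))) :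
    Function.Injective (Halving.word (J := J) e) := by
  intro A B h
  funext j
  ext l
  have := congrFun h (e.symm (j, some l))
  simp only [Halving.word_symm_some] at this
  by_cases hA : l ∈ (A j).1 <;> by_cases hB : l ∈ (B j).1 <;> simp_all

lemma Halving.word_ne_zero [Nonempty J] {r : ℕ} (hr : 0 < r)
    (e : I ≃ J × Option (Fin (2 * r - 1))) (A : Halving J r) : A.word e ≠ 0 := by
  obtain ⟨j⟩ := ‹Nonempty J›
  obtain ⟨l, hl⟩ := Finset.card_pos.1 ((A j).2.symm ▸ hr)
  intro h
  have := congrFun h (e.symm (j, some l))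
  simp [Halving.word_symm_some, hl] at this

lemma Halving.card_fiber {r : ℕ} (hr : 0 < r) (e : I ≃ J × Option (Fin (2 * r - 1)))
    (A : Halving J r) (jb : J × ZMod 2) : #{i | ((e i).1, A.word e i) = jb} = r := by
  obtain ⟨j, b⟩ := jb
  have h1 : #{i | ((e i).1, A.word e i) = (j, 1)} = r := by
    refine Eq.trans ?_ (A j).2
    symm
    refine Finset.card_bij (fun l _ => e.symm (j, some l)) ?_ ?_ ?_
    · intro l hl
      simp [Halving.word_symm_some, hl]
    · intro l _ l' _ h
      simpa using h
    · intro i hi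
      obtain ⟨⟨j', o⟩, rfl⟩ := e.symm.surjective i
      simp only [Finset.mem_filter, Finset.mem_univ, true_and, Equiv.apply_symm_apply,
        Prod.mk.injEq] at hi
      obtain ⟨rfl, hi⟩ := hi
      cases o with
      | none => simp [Halving.word_symm_none] at hi
      | some l =>
        rw [Halving.word_symm_some] at hi
        exact ⟨l, by by_contra h; simp [h] at hi, rfl⟩
  have h2 : #{i | (e i).1 = j} = 2 * r := by
    have : #{i | (e i).1 = j} = #(univ : Finset (Option (Fin (2 * r - 1)))) := by
      symm
      refine Finset.card_bij (fun l _ => e.symm (j, l)) (by simp) (by simp) ?_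
      intro i hi
      obtain ⟨⟨j', o⟩, rfl⟩ := e.symm.surjective i
      exact ⟨o, by simp, by simpa [eq_comm] using hi⟩
    rw [this, Finset.card_univ, Fintype.card_option, Fintype.card_fin]
    omega
  have h3 : #{i | (e i).1 = j} =
      #{i | ((e i).1, A.word e i) = (j, 0)} + #{i | ((e i).1, A.word e i) = (j, 1)} := by
    rw [← Finset.card_union_of_disjoint]
    · congr 1
      ext i
      rcases zmod_two_cases (A.word e i) with h | h <;> simp [h]
    · rw [Finset.disjoint_filter]
      intro i _ h h'
      simp [h] at h'
  rcases zmod_two_cases b with rfl | rfl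
  · omega
  · exact h1

lemma Halving.card_prod (t : ℕ) :
    Nat.card (Halving J (2 ^ t) × ZMod 2) = splitCount (t + 1) (Fintype.card J) := by
  have h : (2 ^ (t + 1)).choose (2 ^ t) = 2 * (2 * 2 ^ t - 1).choose (2 ^ t) := by
    obtain ⟨r, hr⟩ : ∃ r, 2 ^ t = r + 1 := ⟨2 ^ t - 1, by have := Nat.two_pow_pos t; omega⟩
    have h2 : 2 * (r + 1) - 1 = 2 * r + 1 := by omega
    rw [pow_succ, mul_comm, hr, h2, show 2 * (r + 1) = (2 * r + 1) + 1 by ring,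
      Nat.choose_succ_succ, ← Nat.choose_symm_half]
    ring
  rw [Nat.card_prod, Nat.card_fun, Nat.card_zmod, Nat.card_eq_fintype_card (α := {_A // _}),
    Fintype.card_finset_len, Fintype.card_fin, splitCount, Nat.add_sub_cancel, h,
    Nat.mul_div_cancel_left _ two_pos, Nat.card_eq_fintype_card, mul_comm]

/-- A family of types from which a concatenation inherits an additional affine check. -/
def Degenerate {r : ℕ} (e : I ≃ J × Option (Fin (2 * r - 1))) {T : Set (J → ZMod 2)}
    (τ : T → Halving J r × ZMod 2) : Prop :=
  ∃ h₀ q, ∃ a : J → ZMod 2, ∀ w, (τ w).1.word e = h₀ ∧ (τ w).2 = q + ∑ j, a j * w.1 j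

lemma card_degenerate_le [Nonempty J] {r : ℕ} (e : I ≃ (J × ZMod 2) × Option (Fin (2 * r - 1)))
    (v : J → ZMod 2) (p : ZMod 2) :
    Nat.card {τ : outer v p → Halving (J × ZMod 2) r × ZMod 2 // Degenerate e τ} ≤
      Nat.card (Halving (J × ZMod 2) r × ZMod 2) * 2 ^ (Fintype.card J - 1) := by
  obtain ⟨j₀⟩ := ‹Nonempty J›
  have : Nonempty J := ⟨j₀⟩
  rw [← card_fun_ne j₀, ← Nat.card_prod]
  let f : (Halving (J × ZMod 2) r × ZMod 2) × ({j // j ≠ j₀} → ZMod 2) →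
      outer v p → Halving (J × ZMod 2) r × ZMod 2 :=
    fun z w => (z.1.1, z.1.2 + ∑ j : {j // j ≠ j₀}, z.2 j * w.1 (j.1, 1))
  refine (Nat.card_mono (Set.toFinite (Set.range f)) ?_).trans (Finite.card_range_le f)
  rintro τ ⟨h₀, q, a, hτ⟩
  obtain ⟨w₀, hw₀⟩ := outer_nonempty v p
  let δ : J → ZMod 2 := fun j => a (j, 0) + a (j, 1)
  refine ⟨(((τ ⟨w₀, hw₀⟩).1, q + ∑ j, a (j, 0) * v j + δ j₀ * p), fun j => δ j + δ j₀), ?_⟩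
  funext w
  refine Prod.ext (Halving.word_injective e ((hτ _).1.trans (hτ w).1.symm)) ?_
  have h1 : ∑ jb, a jb * w.1 jb = ∑ j, a (j, 0) * v j + ∑ j, δ j * w.1 (j, 1) := by
    rw [Fintype.sum_prod_type, ← Finset.sum_add_distrib]
    refine Finset.sum_congr rfl fun j _ => ?_
    have hw := congrFun w.2.1 j
    rw [colSum_fst] at hw
    rw [sum_zmod_two, ← hw]
    have := CharTwo.add_self_eq_zero (a (j, 0) * w.1 (j, 1))
    linear_combination -this
  have h2 : ∑ j, (δ j + δ j₀) * w.1 (j, 1) = ∑ j, δ j * w.1 (j, 1) + δ j₀ * p := by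
    simp only [add_mul, Finset.sum_add_distrib, ← Finset.mul_sum]
    rw [w.2.2]
  rw [Fintype.sum_eq_add_sum_subtype_ne _ j₀, CharTwo.add_self_eq_zero, zero_mul, zero_add] at h2
  simp only [f]
  rw [h2, (hτ w).2, h1]
  have := CharTwo.add_self_eq_zero (δ j₀ * p)
  linear_combination this

lemma exists_equiv_of_card_fiber {L : Type} [Fintype L] (κ : I → J)
    (h : ∀ j, #{i | κ i = j} = Fintype.card L) : ∃ e : I ≃ J × L, ∀ i, (e i).1 = κ i := by
  have h' : ∀ j, Nonempty ({i // κ i = j} ≃ L) := fun j =>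
    ⟨Fintype.equivOfCardEq (by rw [Fintype.card_subtype, h])⟩
  let f := fun j => (h' j).some
  exact ⟨(Equiv.sigmaFiberEquiv κ).symm.trans
    ((Equiv.sigmaCongrRight f).trans (Equiv.sigmaEquivProd J L)), fun i => rfl⟩

lemma pow_sub_mul_pow_le [Nonempty J] {s ℓ : ℕ} {κ : I → J} {v : J → ZMod 2} {h : I → ZMod 2}
    {p : ZMod 2} (hκ : ∀ jb, #{i | (κ i, h i) = jb} = 2 ^ (s + 1))
    (hℓ : ∀ (w : J × ZMod 2 → ZMod 2) (h' : I → ZMod 2) (p' : ZMod 2),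
      (∀ jb, #{i | ((κ i, h i), h' i) = jb} = 2 ^ s) →
        ℓ ≤ Nat.card {G // Good (s + 1) (fun i => (κ i, h i)) w h' p' G}) :
    (splitCount (s + 1) (2 * Fintype.card J) ^ 2 ^ (Fintype.card J - 1) -
      splitCount (s + 1) (2 * Fintype.card J) * 2 ^ (Fintype.card J - 1)) *
        ℓ ^ 2 ^ (Fintype.card J - 1) ≤ Nat.card {G // Good (s + 2) κ v h p G} := by
  classical
  have hpos : 0 < 2 ^ s := Nat.two_pow_pos s
  obtain ⟨e, he⟩ := exists_equiv_of_card_fiber (L := Option (Fin (2 * 2 ^ s - 1)))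
    (fun i => (κ i, h i)) fun jb => by
      rw [hκ, Fintype.card_option, Fintype.card_fin, pow_succ]; omega
  let Ty := Halving (J × ZMod 2) (2 ^ s) × ZMod 2
  let b : J × ZMod 2 → I := fun jb => e.symm (jb, none)
  have hb : ∀ jb, (κ (b jb), h (b jb)) = jb := fun jb => by rw [← he]; simp [b]
  have hsurj : Function.Surjective fun i => (κ i, h i) := fun jb => ⟨b jb, hb jb⟩
  let P : {τ : outer v p → Ty // ¬ Degenerate e τ} → outer v p → Type := fun τ w =>
    {G // Good (s + 1) (fun i => (κ i, h i)) w.1 ((τ.1 w).1.word e) (τ.1 w).2 G}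
  let Φ : (Σ τ, ∀ w, P τ w) → {G // Good (s + 2) κ v h p G} := fun z =>
    ⟨⋃ w, (z.2 w).1, Good.iUnion (fun w => (z.2 w).2) hb
      (fun w jb => Halving.word_symm_none e _ jb) z.1.2⟩
  have hrec : ∀ z : Σ τ, ∀ w, P τ w, ∀ w,
      (z.2 w).1 = {x ∈ (Φ z).1 | colSum (fun i => (κ i, h i)) x = w} := by
    intro z w
    ext x
    constructor
    · exact fun hx => ⟨Set.mem_iUnion.2 ⟨w, hx⟩, (z.2 w).2.component.1 x hx⟩
    · rintro ⟨hx, hxw⟩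
      obtain ⟨w', hw'⟩ := Set.mem_iUnion.1 hx
      have : w' = w := Subtype.ext (((z.2 w').2.component.1 x hw').symm.trans hxw)
      exact this ▸ hw'
  have hΦ : Function.Injective Φ := by
    rintro ⟨τ, F⟩ ⟨τ', F'⟩ hz
    have hFF : ∀ w, (F w).1 = (F' w).1 := fun w => by
      have h1 := hrec ⟨τ, F⟩ w
      rw [hz, ← hrec ⟨τ', F'⟩ w] at h1
      exact h1
    have hτ : τ = τ' := by
      refine Subtype.ext (funext fun w => ?_)
      have := (F w).2.type_unique (h' := (τ'.1 w).1.word e) (p' := (τ'.1 w).2)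
        ((hFF w).symm ▸ (F' w).2) ((F w).2.component.nonempty hsurj) hb
        (Halving.word_symm_none e _) (Halving.word_symm_none e _) (Halving.word_ne_zero hpos e _)
      exact Prod.ext (Halving.word_injective e this.1) this.2
    subst hτ
    congr 1
    exact funext fun w => Subtype.ext (hFF w)
  have hT : Nat.card Ty = splitCount (s + 1) (2 * Fintype.card J) := by
    rw [Halving.card_prod, Fintype.card_prod, ZMod.card, mul_comm]
  have hcard : splitCount (s + 1) (2 * Fintype.card J) ^ 2 ^ (Fintype.card J - 1) -
      splitCount (s + 1) (2 * Fintype.card J) * 2 ^ (Fintype.card J - 1) ≤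
        Nat.card {τ : outer v p → Ty // ¬ Degenerate e τ} := by
    have h1 := card_degenerate_le e v p
    rw [hT] at h1
    have h2 : Nat.card (outer v p → Ty) =
        splitCount (s + 1) (2 * Fintype.card J) ^ 2 ^ (Fintype.card J - 1) := by
      rw [Nat.card_fun, hT, card_outer]
    have h3 : Nat.card {τ : outer v p → Ty // ¬ Degenerate e τ} = Nat.card (outer v p → Ty) -
        Nat.card {τ : outer v p → Ty // Degenerate e τ} := by
      simp only [Nat.card_eq_fintype_card, Fintype.card_subtype_compl]
    rw [h3, h2]
    exact Nat.sub_le_sub_left h1 _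
  refine le_trans ?_ (Nat.card_le_card_of_injective Φ hΦ)
  rw [Nat.card_sigma]
  refine (Nat.mul_le_mul_right _ hcard).trans ?_
  rw [Nat.card_eq_fintype_card, ← Finset.card_univ, ← smul_eq_mul]
  refine Finset.card_nsmul_le_sum _ _ _ fun τ _ => ?_
  rw [Nat.card_pi]
  refine le_trans (le_of_eq ?_) (Finset.pow_card_le_prod univ _ ℓ fun w _ => hℓ _ _ _ fun jb => ?_)
  · rw [← card_outer v p, Finset.card_univ, Nat.card_eq_fintype_card]
  · simp only [← he]
    exact Halving.card_fiber hpos e _ jb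

theorem goodCount_le_card (s : ℕ) : ∀ {I J : Type} [Fintype I] [Fintype J] [DecidableEq I]
    [DecidableEq J] [Nonempty J] (κ : I → J) (v : J → ZMod 2) (h : I → ZMod 2) (p : ZMod 2),
    (∀ jb, #{i | (κ i, h i) = jb} = 2 ^ s) →
      goodCount s (Fintype.card J) ≤ Nat.card {G // Good (s + 1) κ v h p G} := by
  induction s with
  | zero =>
    intro I J _ _ _ _ _ κ v h p hκ
    have hb : Function.Bijective fun i => (κ i, h i) := by
      refine (Function.bijective_iff_existsUnique _).2 fun jb => ?_
      obtain ⟨i, hi⟩ := Finset.card_eq_one.1 (hκ jb)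
      have := fun i' => Finset.ext_iff.1 hi i'
      simp only [Finset.mem_filter, Finset.mem_univ, true_and, Finset.mem_singleton] at this
      exact ⟨i, (this i).2 rfl, fun i' hi' => (this i').1 hi'⟩
    exact Nat.card_pos_iff.2 ⟨⟨⟨_, good_one hb v p⟩⟩, inferInstance⟩
  | succ s ih =>
    intro I J _ _ _ _ _ κ v h p hκ
    refine pow_sub_mul_pow_le hκ fun w h' p' hh' => ?_
    have := ih (fun i => (κ i, h i)) w h' p' hh'
    rwa [Fintype.card_prod, ZMod.card, mul_comm] at this

end Counting

section Isometries

variable {N : ℕ}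

lemma hammingDist_eq_norm_add (x y : Word N) : hammingDist x y = hammingNorm (x + y) := by
  rw [hammingDist_eq_hammingNorm]
  congr 1
  exact funext fun i => by simp [CharTwo.neg_eq]

lemma hammingNorm_eq_one_iff (x : Word N) : hammingNorm x = 1 ↔ ∃ i, x = Pi.single i 1 := by
  constructor
  · intro h
    obtain ⟨i, hi⟩ := Finset.card_eq_one.1 h
    refine ⟨i, funext fun k => ?_⟩
    have := Finset.ext_iff.1 hi k
    simp only [Finset.mem_filter, Finset.mem_univ, true_and, Finset.mem_singleton] at this
    rcases zmod_two_cases (x k) with hk | hk <;> by_cases hik : k = i <;> simp_all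
  · rintro ⟨i, rfl⟩
    rw [hammingNorm, Finset.card_eq_one]
    exact ⟨i, by ext k; simp [Pi.single_apply]⟩

lemma hammingDist_le_one_iff (x y : Word N) :
    hammingDist x y ≤ 1 ↔ x = y ∨ ∃ i, x = y + Pi.single i 1 := by
  rw [Nat.le_one_iff_eq_zero_or_eq_one, hammingDist_eq_zero, hammingDist_eq_norm_add,
    hammingNorm_eq_one_iff]
  refine or_congr_right (exists_congr fun i => ⟨fun h => ?_, fun h => ?_⟩)
  · rw [← h, add_comm x, ← add_assoc, word_add_self, zero_add]
  · rw [h, add_right_comm, word_add_self, zero_add]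

lemma eq_one_iff_hammingNorm_lt (x : Word N) (i : Fin N) :
    x i = 1 ↔ hammingNorm (x + Pi.single i 1) < hammingNorm x := by
  rcases zmod_two_cases (x i) with h | h
  · simp only [h, zero_ne_one, false_iff, not_lt]
    refine Finset.card_le_card fun k hk => ?_
    have hki : k ≠ i := by rintro rfl; simp [h] at hk
    simpa [Pi.single_apply, hki] using hk
  · simp only [h, true_iff]
    refine Finset.card_lt_card ⟨fun k hk => ?_, fun hs => ?_⟩
    · have hki : k ≠ i := by rintro rfl; simp [h, CharTwo.add_self_eq_zero] at hk
      simpa [Pi.single_apply, hki] using hk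
    · have := @hs i (by simp [h])
      simp [h, CharTwo.add_self_eq_zero] at this

/-- An isometry of the binary Hamming space is a coordinate permutation followed by a
translation. -/
lemma exists_perm_of_isIsometry {g : Word N → Word N} (hg : IsIsometry g) :
    ∃ σ : Equiv.Perm (Fin N), ∀ x, g x = x ∘ σ + g 0 := by
  have hd : ∀ x y, hammingNorm (g x + g y) = hammingNorm (x + y) := fun x y => by
    rw [← hammingDist_eq_norm_add, hg.2, hammingDist_eq_norm_add]
  have h1 : ∀ i, ∃ k, g (Pi.single i 1) + g 0 = Pi.single k 1 := fun i => by
    rw [← hammingNorm_eq_one_iff, hd, add_zero, hammingNorm_eq_one_iff]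
    exact ⟨i, rfl⟩
  choose s hs using h1
  have hsi : Function.Injective s := fun i k h => by
    have h2 := (hs i).trans ((congrArg (fun k => Pi.single k 1) h).trans (hs k).symm)
    have h3 := hg.1.1 (add_right_cancel h2)
    by_contra hne
    have := congrFun h3 i
    simp [hne] at this
  have hx : ∀ x i, (g x + g 0) (s i) = x i := fun x i => by
    have h2 : (g x + g 0) (s i) = 1 ↔ x i = 1 := by
      rw [eq_one_iff_hammingNorm_lt, eq_one_iff_hammingNorm_lt, ← hs, hd, add_zero,
        add_add_add_comm, word_add_self, add_zero, hd]
    rcases zmod_two_cases (x i) with h | h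
    · rw [h] at h2 ⊢
      exact (zmod_two_cases _).resolve_right fun h' => zero_ne_one (h2.1 h')
    · rw [h] at h2 ⊢
      exact h2.2 rfl
  let e := Equiv.ofBijective s (Finite.injective_iff_bijective.1 hsi)
  refine ⟨e.symm, fun x => ?_⟩
  have h3 : g x + g 0 = x ∘ e.symm := funext fun k => by
    have := hx x (e.symm k)
    rwa [show s (e.symm k) = k from e.apply_symm_apply k] at this
  rw [← h3, add_assoc, word_add_self, add_zero]

lemma codeEquiv_equivalence (N : ℕ) : Equivalence (codeEquiv N) where
  refl C := ⟨id, ⟨Function.bijective_id, fun _ _ => rfl⟩, by simp⟩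
  symm := by
    rintro C D ⟨g, hg, h⟩
    let e := Equiv.ofBijective g hg.1
    have he : ∀ x, g (e.symm x) = x := e.apply_symm_apply
    refine ⟨e.symm, ⟨e.symm.bijective, fun x y => ?_⟩, ?_⟩
    · rw [← hg.2, he, he]
    · rw [h]
      exact (e.symm_image_image C.1).symm
  trans := by
    rintro C D E ⟨g, hg, h⟩ ⟨g', hg', h'⟩
    exact ⟨g' ∘ g, ⟨hg'.1.comp hg.1, fun x y => by simp only [Function.comp, hg'.2, hg.2]⟩, by
      rw [h', h, Set.image_image]; rfl⟩

/-- The size of an equivalence class of codes with many translations preserving it. -/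
lemma card_images_mul_le (C : Set (Word N)) :
    Nat.card {D : Set (Word N) // ∃ g, IsIsometry g ∧ D = g '' C} *
        Nat.card {z : Word N // ∀ x ∈ C, x + z ∈ C} ≤ N.factorial * 2 ^ N := by
  have hD : ∀ D : {D : Set (Word N) // ∃ g, IsIsometry g ∧ D = g '' C},
      ∃ z : Equiv.Perm (Fin N) × Word N, D.1 = (fun x => x ∘ z.1 + z.2) '' C := by
    rintro ⟨D, g, hg, rfl⟩
    obtain ⟨σ, hσ⟩ := exists_perm_of_isIsometry hg
    exact ⟨(σ, g 0), Set.image_congr fun x _ => hσ x⟩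
  choose f hf using hD
  have hinj : Function.Injective fun y : {D : Set (Word N) // ∃ g, IsIsometry g ∧ D = g '' C} ×
      {z : Word N // ∀ x ∈ C, x + z ∈ C} => ((f y.1).1, (f y.1).2 + y.2.1 ∘ (f y.1).1) := by
    have key : ∀ y : {D : Set (Word N) // ∃ g, IsIsometry g ∧ D = g '' C} ×
        {z : Word N // ∀ x ∈ C, x + z ∈ C},
        y.1.1 = (fun x => x ∘ (f y.1).1 + ((f y.1).2 + y.2.1 ∘ (f y.1).1)) '' C := by
      rintro ⟨D, z, hz⟩
      have hcomp : ∀ x : Word N, x ∘ (f D).1 + ((f D).2 + z ∘ (f D).1) =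
          (x + z) ∘ (f D).1 + (f D).2 := fun x => by
        rw [add_comm (f D).2, ← add_assoc]; rfl
      simp only [hcomp]
      refine (hf D).trans (Set.Subset.antisymm ?_ ?_)
      · rintro _ ⟨x, hx, rfl⟩
        refine ⟨x + z, hz x hx, ?_⟩
        simp only [add_assoc, word_add_self, add_zero]
      · rintro _ ⟨x, hx, rfl⟩
        exact ⟨x + z, hz x hx, rfl⟩
    intro y y' h
    simp only [Prod.mk.injEq] at h
    have h1 : y.1 = y'.1 := Subtype.ext (by rw [key y, key y', h.2, h.1])
    refine Prod.ext h1 (Subtype.ext ?_)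
    have h2 := h.2
    rw [h1] at h2
    exact (f y'.1).1.surjective.injective_comp_right (add_left_cancel h2)
  have := Nat.card_le_card_of_injective _ hinj
  simpa [Nat.card_prod, Fintype.card_perm] using this

end Isometries

section Extension

/-- Extended perfect codes on an arbitrary index set. -/
def IsExtended {I : Type} [Fintype I] [DecidableEq I] (G : Set (I → ZMod 2)) : Prop :=
  (∀ x ∈ G, ∑ i, x i = 0) ∧ ∀ y : I → ZMod 2, ∑ i, y i = 1 → ∃! i, y + Pi.single i 1 ∈ G

variable {N : ℕ}

/-- Extension of a word by a parity check. -/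
def parityExt (x : Word N) (o : Option (Fin N)) : ZMod 2 := o.elim (∑ i, x i) x

/-- Deletion of the parity check. -/
def puncture (G : Set (Option (Fin N) → ZMod 2)) : Set (Word N) := {x | parityExt x ∈ G}

lemma parityExt_add (x y : Word N) : parityExt (x + y) = parityExt x + parityExt y := by
  funext o
  cases o <;> simp [parityExt, Finset.sum_add_distrib]

lemma parityExt_single (k : Fin N) :
    parityExt (Pi.single k 1) = Pi.single none 1 + Pi.single (some k) 1 := by
  funext o
  cases o <;> simp [parityExt, Pi.single_apply]

lemma sum_parityExt (x : Word N) : ∑ o, parityExt x o = 0 := by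
  rw [Fintype.sum_option]
  exact CharTwo.add_self_eq_zero _

lemma parityExt_comp_some {x : Option (Fin N) → ZMod 2} (hx : ∑ o, x o = 0) :
    parityExt (x ∘ some) = x := by
  rw [Fintype.sum_option] at hx
  funext o
  cases o with
  | none => exact (CharTwo.add_eq_zero.1 hx).symm
  | some k => rfl

lemma parityExt_injective : Function.Injective (parityExt (N := N)) := fun _ _ h =>
  funext fun k => congrFun h (some k)

lemma IsExtended.perfect1_puncture {G : Set (Option (Fin N) → ZMod 2)} (hG : IsExtended G) :
    Perfect1 (puncture G) := by
  intro y
  have h1 : ∑ o, (parityExt y + Pi.single none 1 : Option (Fin N) → ZMod 2) o = 1 := by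
    simp only [Pi.add_apply, Finset.sum_add_distrib, sum_parityExt]
    simp
  have hnone : parityExt y + Pi.single none 1 + Pi.single none 1 = parityExt y := by
    rw [add_assoc, word_add_self, add_zero]
  have hsome : ∀ k, parityExt y + Pi.single none 1 + Pi.single (some k) 1 =
      parityExt (y + Pi.single k 1) := fun k => by
    rw [parityExt_add, parityExt_single, add_assoc]
  obtain ⟨o, ho, hou⟩ := hG.2 _ h1
  have huniq : ∀ x, x ∈ puncture G ∧ hammingDist x y ≤ 1 →
      parityExt x = parityExt y + Pi.single none 1 + Pi.single o 1 := by
    rintro x ⟨hx, hxy⟩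
    rcases (hammingDist_le_one_iff x y).1 hxy with rfl | ⟨k, rfl⟩
    · rw [← hou none (by simp only [hnone]; exact hx), hnone]
    · rw [← hou (some k) (by simp only [hsome]; exact hx), hsome]
  refine existsUnique_of_exists_of_unique ?_ fun x x' hx hx' =>
    parityExt_injective ((huniq x hx).trans (huniq x' hx').symm)
  cases o with
  | none => exact ⟨y, by rw [hnone] at ho; exact ho, by simp⟩
  | some k =>
    exact ⟨y + Pi.single k 1, by rw [hsome] at ho; exact ho,
      (hammingDist_le_one_iff _ _).2 (Or.inr ⟨k, rfl⟩)⟩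

lemma IsExtended.eq_of_puncture_eq {G G' : Set (Option (Fin N) → ZMod 2)} (hG : IsExtended G)
    (hG' : IsExtended G') (h : puncture G = puncture G') : G = G' := by
  have key : ∀ x, ∑ o, x o = 0 → (x ∈ G ↔ x ∈ G') := fun x hx => by
    have := Set.ext_iff.1 h (x ∘ some)
    simpa only [puncture, Set.mem_ofPred_eq, parityExt_comp_some hx] using this
  exact Set.ext fun x => ⟨fun hx => (key x (hG.1 x hx)).1 hx, fun hx => (key x (hG'.1 x hx)).2 hx⟩

lemma card_le_card_translations {α : Type} {G : Set (Option (Fin N) → ZMod 2)}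
    {φ : α → Option (Fin N) → ZMod 2} (hφ : Function.Injective φ)
    (h0 : ∀ u, ∑ o, φ u o = 0) (hG : ∀ u, ∀ x ∈ G, x + φ u ∈ G) :
    Nat.card α ≤ Nat.card {z : Word N // ∀ x ∈ puncture G, x + z ∈ puncture G} := by
  refine Nat.card_le_card_of_injective (fun u => ⟨φ u ∘ some, fun x hx => ?_⟩) fun u u' h => ?_
  · rw [puncture, Set.mem_ofPred_eq, parityExt_add, parityExt_comp_some (h0 u)]
    exact hG u _ hx
  · refine hφ ?_
    rw [← parityExt_comp_some (h0 u), ← parityExt_comp_some (h0 u')]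
    exact congrArg parityExt (Subtype.ext_iff.1 h)

variable {I : Type} [Fintype I] [DecidableEq I]

/-- Action of coordinate permutations on codes. -/
def permute (π : Equiv.Perm I) (G : Set (I → ZMod 2)) : Set (I → ZMod 2) := {x | x ∘ π ∈ G}

lemma IsExtended.permute {G : Set (I → ZMod 2)} (hG : IsExtended G) (π : Equiv.Perm I) :
    IsExtended (permute π G) := by
  refine ⟨fun x hx => by rw [← Equiv.sum_comp π]; exact hG.1 _ hx, fun y hy => ?_⟩
  have hs : ∀ i, (y + Pi.single (π i) 1) ∘ π = y ∘ π + Pi.single i 1 := fun i => by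
    funext k
    simp [Pi.single_apply]
  obtain ⟨i, hi, hiu⟩ := hG.2 (y ∘ π) (by rw [← hy]; exact Equiv.sum_comp π y)
  refine ⟨π i, by simpa only [PerfectCode.permute, Set.mem_ofPred_eq, hs] using hi,
    fun i' hi' => ?_⟩
  obtain ⟨i', rfl⟩ := π.surjective i'
  rw [hiu i' (by simpa only [PerfectCode.permute, Set.mem_ofPred_eq, hs] using hi')]

lemma Good.isExtended {t : ℕ} {κ : I → ZMod 2} {s p : ZMod 2} {h : I → ZMod 2}
    {G : Set (I → ZMod 2)} (hG : Good t κ (fun _ => s) h p G) : IsExtended G := by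
  have hsum : ∀ x, ∑ i, x i = colSum κ x 0 + colSum κ x 1 := fun x => by
    have := sum_mul_colSum κ (fun _ => 1) x
    simpa only [one_mul, sum_zmod_two] using this.symm
  refine ⟨fun x hx => ?_, fun y hy => hG.component.2 y (colSum κ y 0 + s + 1) ?_⟩
  · rw [hsum, hG.component.1 x hx, CharTwo.add_self_eq_zero]
  · rw [hsum] at hy
    have key : ∀ c d s : ZMod 2, c + d = 1 →
        c = s + (Pi.single (c + s + 1) 1 : ZMod 2 → ZMod 2) 0 ∧
        d = s + (Pi.single (c + s + 1) 1 : ZMod 2 → ZMod 2) 1 := by decide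
    funext j
    rcases zmod_two_cases j with rfl | rfl
    · exact (key _ _ s hy).1
    · exact (key _ _ s hy).2

end Extension

section Orbits

variable {I Q : Type} [Fintype I] [Fintype Q] [DecidableEq I] [DecidableEq Q]

lemma surjective_of_card_fiber {q : I → Q} {k : ℕ} (hk : k ≠ 0)
    (hq : ∀ b, #{i | q i = b} = k) : Function.Surjective q := fun b => by
  have : 0 < #{i | q i = b} := by rw [hq]; exact Nat.pos_of_ne_zero hk
  obtain ⟨i, hi⟩ := Finset.card_pos.1 this
  exact ⟨i, (Finset.mem_filter.1 hi).2⟩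

lemma card_perm_comp_eq_le (q : I → Q) (σ : Equiv.Perm Q) {k : ℕ}
    (hq : ∀ b, #{i | q i = b} = k) :
    Nat.card {ρ : Equiv.Perm I // q ∘ ρ = σ ∘ q} ≤ k.factorial ^ Fintype.card Q := by
  rcases isEmpty_or_nonempty {ρ : Equiv.Perm I // q ∘ ρ = σ ∘ q} with h | ⟨⟨ρ₀, h₀⟩⟩
  · simp
  have hs := DomMulAct.stabilizer_card q
  have hle : Nat.card {ρ : Equiv.Perm I // q ∘ ρ = σ ∘ q} ≤
      Nat.card {g : Equiv.Perm I // q ∘ g = q} := by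
    refine Nat.card_le_card_of_injective (fun ρ => ⟨ρ₀.symm.trans ρ.1, ?_⟩) fun ρ ρ' h => ?_
    · funext i
      have h1 := congrFun ρ.2 (ρ₀.symm i)
      have h2 := congrFun h₀ (ρ₀.symm i)
      simp only [Function.comp_apply, Equiv.apply_symm_apply] at h1 h2
      simp [h1, h2]
    · refine Subtype.ext (Equiv.ext fun i => ?_)
      have := Equiv.ext_iff.1 (Subtype.ext_iff.1 h) (ρ₀ i)
      simpa using this
  refine hle.trans (le_of_eq ?_)
  rw [Nat.card_eq_fintype_card, hs]
  simp [Fintype.card_subtype, hq]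

/-- The permutations acting on the fibers of `q` are few. -/
lemma card_perm_fibers_le (q : I → Q) {k : ℕ} (hq : ∀ b, #{i | q i = b} = k) :
    Nat.card {ρ : Equiv.Perm I // ∃ σ : Equiv.Perm Q, q ∘ ρ = σ ∘ q} ≤
      (Fintype.card Q).factorial * k.factorial ^ Fintype.card Q := by
  classical
  have hinj : Function.Injective
      fun ρ : {ρ : Equiv.Perm I // ∃ σ : Equiv.Perm Q, q ∘ ρ = σ ∘ q} =>
        (⟨ρ.2.choose, ρ.1, ρ.2.choose_spec⟩ :
          Σ σ : Equiv.Perm Q, {ρ : Equiv.Perm I // q ∘ ρ = σ ∘ q}) := by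
    intro ρ ρ' he
    exact Subtype.ext (congrArg (fun z : Σ σ : Equiv.Perm Q,
      {ρ : Equiv.Perm I // q ∘ ρ = σ ∘ q} => z.2.1) he)
  refine (Nat.card_le_card_of_injective _ hinj).trans ?_
  rw [Nat.card_sigma]
  refine (Finset.sum_le_card_nsmul _ _ _ fun σ _ => card_perm_comp_eq_le q σ hq).trans ?_
  simp [Fintype.card_perm]

lemma exists_perm_of_forall {q : I → Q} (hq : Function.Surjective q) {ρ : Equiv.Perm I}
    (h : ∀ i j, q i = q j → q (ρ i) = q (ρ j)) : ∃ σ : Equiv.Perm Q, q ∘ ρ = σ ∘ q := by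
  let g : Q → Q := fun b => q (ρ (hq b).choose)
  have hg : ∀ i, g (q i) = q (ρ i) := fun i => h _ _ (hq (q i)).choose_spec
  have hs : Function.Surjective g := fun b => by
    obtain ⟨i, rfl⟩ := hq b
    exact ⟨q (ρ.symm i), by rw [hg, Equiv.apply_symm_apply]⟩
  exact ⟨Equiv.ofBijective g (Finite.surjective_iff_bijective.1 hs), funext fun i => (hg i).symm⟩

end Orbits

section Family

variable {I : Type} [Fintype I] [DecidableEq I]

/-- The codes obtained by iterated splitting with respect to the partition given by `κ`, `h`. -/
def IsFamily (t : ℕ) (κ h : I → ZMod 2) (G : Set (I → ZMod 2)) : Prop :=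
  ∃ s p, Good t κ (fun _ => s) h p G

lemma Good.nonempty {J : Type} [Fintype J] [DecidableEq J] [Nonempty J] {t : ℕ} {κ : I → J}
    {v : J → ZMod 2} {h : I → ZMod 2} {p : ZMod 2} {G : Set (I → ZMod 2)}
    (hG : Good t κ v h p G) (hκ : Function.Surjective κ) : G.Nonempty :=
  hG.component.nonempty hκ

lemma four_mul_goodCount_le {s k : ℕ} (hk : k = 2 ^ s) {κ h : I → ZMod 2}
    (hq : ∀ b : ZMod 2 × ZMod 2, #{i | (κ i, h i) = b} = k) :
    4 * goodCount s 2 ≤ Nat.card {G // IsFamily (s + 1) κ h G} := by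
  subst hk
  have hκ : Function.Surjective κ :=
    Prod.fst_surjective.comp (surjective_of_card_fiber (by positivity) hq)
  have hinj : Function.Injective fun y : (Σ z : ZMod 2 × ZMod 2,
      {G // Good (s + 1) κ (fun _ => z.1) h z.2 G}) =>
      (⟨y.2.1, y.1.1, y.1.2, y.2.2⟩ : {G // IsFamily (s + 1) κ h G}) := by
    rintro ⟨⟨a, b⟩, G, hG⟩ ⟨⟨a', b'⟩, G', hG'⟩ he
    obtain rfl : G = G' := Subtype.ext_iff.1 he
    obtain ⟨x, hx⟩ := hG.nonempty hκ
    obtain rfl : a = a' :=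
      congrFun ((hG.component.1 x hx).symm.trans (hG'.component.1 x hx)) 0
    obtain rfl : b = b' := (hG.check x hx).symm.trans (hG'.check x hx)
    rfl
  refine le_trans ?_ (Nat.card_le_card_of_injective _ hinj)
  rw [Nat.card_sigma]
  refine le_trans ?_ (Finset.card_nsmul_le_sum _ _ (goodCount s 2) fun z _ => ?_)
  · simp
  · exact goodCount_le_card s κ (fun _ => z.1) h z.2 hq

/-- The affine checks of a code. -/
def IsCheck (G : Set (I → ZMod 2)) (g : I → ZMod 2) : Prop := ∃ r, ∀ x ∈ G, ∑ i, g i * x i = r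

lemma IsFamily.isCheck_iff {t : ℕ} {κ h : I → ZMod 2} {G : Set (I → ZMod 2)}
    (hG : IsFamily t κ h G) (g : I → ZMod 2) :
    IsCheck G g ↔ ∃ (c : ZMod 2) (a : ZMod 2 → ZMod 2), ∀ i, g i = c * h i + a (κ i) := by
  obtain ⟨s, p, hG⟩ := hG
  refine ⟨fun ⟨r, hr⟩ => hG.dual g r hr, fun ⟨c, a, hg⟩ => ⟨c * p + ∑ j, a j * s, fun x hx => ?_⟩⟩
  simp only [hg, add_mul, Finset.sum_add_distrib, mul_assoc, ← Finset.mul_sum, hG.check x hx]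
  rw [← sum_mul_colSum, hG.component.1 x hx]

lemma isCheck_permute {G : Set (I → ZMod 2)} (π : Equiv.Perm I) (g : I → ZMod 2) :
    IsCheck (permute π G) g ↔ IsCheck G (g ∘ π) := by
  refine exists_congr fun r => ⟨fun h x hx => ?_, fun h x hx => ?_⟩
  · rw [← h (x ∘ π.symm) (by simpa [permute, Function.comp_assoc] using hx),
      ← Equiv.sum_comp π (fun i => g i * (x ∘ π.symm) i)]
    simp
  · rw [← h _ hx, ← Equiv.sum_comp π]
    rfl

/-- A permutation carrying a member of the family to another one preserves the partition. -/
lemma IsFamily.exists_perm {t : ℕ} {κ h : I → ZMod 2} {G G₀ : Set (I → ZMod 2)}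
    (hG : IsFamily t κ h G) (hG₀ : IsFamily t κ h G₀)
    (hq : Function.Surjective fun i => (κ i, h i)) {π π₀ : Equiv.Perm I}
    (he : permute π G = permute π₀ G₀) :
    ∃ σ : Equiv.Perm (ZMod 2 × ZMod 2),
      (fun i => (κ i, h i)) ∘ (π.trans π₀.symm) = σ ∘ fun i => (κ i, h i) := by
  have key : ∀ f, IsCheck G₀ f → ∀ i j, (κ i, h i) = (κ j, h j) →
      f (π₀.symm (π i)) = f (π₀.symm (π j)) := fun f hf i j hij => by
    have h1 : IsCheck G ((f ∘ π₀.symm) ∘ π) := by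
      rw [← isCheck_permute, he, isCheck_permute]
      simpa [Function.comp_assoc] using hf
    obtain ⟨c, a, hca⟩ := (hG.isCheck_iff _).1 h1
    obtain ⟨h2, h3⟩ : κ i = κ j ∧ h i = h j := Prod.ext_iff.1 hij
    have h4 := hca i
    rw [h2, h3] at h4
    exact h4.trans (hca j).symm
  refine exists_perm_of_forall hq fun i j hij => Prod.ext (key κ ?_ i j hij) (key h ?_ i j hij)
  · exact (hG₀.isCheck_iff _).2 ⟨0, id, fun i => by simp⟩
  · exact (hG₀.isCheck_iff _).2 ⟨1, 0, fun i => by simp⟩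

lemma permute_injective (π : Equiv.Perm I) : Function.Injective (permute π) := fun G G' h => by
  ext x
  have := Set.ext_iff.1 h (x ∘ π.symm)
  simpa [permute, Function.comp_assoc] using this

lemma card_family_mul_le {N t k : ℕ} {κ h : Option (Fin N) → ZMod 2}
    (hk : k ≠ 0) (hq : ∀ b : ZMod 2 × ZMod 2, #{i | (κ i, h i) = b} = k)
    {C : Set (Word N)} :
    Nat.card {z : Equiv.Perm (Option (Fin N)) × {G // IsFamily t κ h G} //
      puncture (permute z.1 z.2.1) = C} ≤ 24 * k.factorial ^ 4 := by
  have hqs := surjective_of_card_fiber hk hq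
  rcases isEmpty_or_nonempty {z : Equiv.Perm (Option (Fin N)) × {G // IsFamily t κ h G} //
      puncture (permute z.1 z.2.1) = C} with hC | ⟨⟨⟨π₀, G₀⟩, h₀⟩⟩
  · simp
  have hext : ∀ z : {z : Equiv.Perm (Option (Fin N)) × {G // IsFamily t κ h G} //
      puncture (permute z.1 z.2.1) = C}, permute z.1.1 z.1.2.1 = permute π₀ G₀.1 := fun z => by
    obtain ⟨s, p, hG⟩ := z.1.2.2
    obtain ⟨s₀, p₀, hG₀⟩ := G₀.2
    exact (hG.isExtended.permute _).eq_of_puncture_eq (hG₀.isExtended.permute _)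
      (z.2.trans h₀.symm)
  have hle := card_perm_fibers_le (fun i => (κ i, h i)) hq
  rw [Fintype.card_prod, ZMod.card] at hle
  refine le_trans (Nat.card_le_card_of_injective (fun z => ⟨z.1.1.trans π₀.symm,
    z.1.2.2.exists_perm G₀.2 hqs (hext z)⟩) fun z z' hz => ?_) hle
  have h1 : z.1.1 = z'.1.1 := Equiv.ext fun i => by
    simpa using Equiv.ext_iff.1 (Subtype.ext_iff.1 hz) i
  refine Subtype.ext (Prod.ext h1 (Subtype.ext (permute_injective z.1.1 ?_)))
  rw [hext, h1, hext]

lemma card_mul_le_of_fiber {α β : Type} [Finite α] [Finite β] (f : α → β) (n : ℕ)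
    (h : ∀ b, Nat.card {a // f a = b} ≤ n) : Nat.card α ≤ n * Nat.card (Set.range f) := by
  classical
  have := Fintype.ofFinite α
  have := Fintype.ofFinite β
  have h1 := Finset.card_le_mul_card_image (f := f) univ n fun b _ => by
    rw [← Fintype.card_subtype, ← Nat.card_eq_fintype_card]
    exact h b
  have h2 : Nat.card (Set.range f) = #(univ.image f) := by
    rw [← Set.toFinset_range, Set.toFinset_card, Nat.card_eq_fintype_card]
  rw [h2, Nat.card_eq_fintype_card]
  exact h1

/-- Each code of the family, whatever the order of its coordinates, is preserved by sixteen
translations. -/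
lemma IsFamily.sixteen_le {N t k : ℕ} (ht : 3 ≤ t) {κ h : Option (Fin N) → ZMod 2}
    (hk : k ≠ 0) (hke : Even k) (hq : ∀ b : ZMod 2 × ZMod 2, #{i | (κ i, h i) = b} = k)
    {G : Set (Option (Fin N) → ZMod 2)} (hG : IsFamily t κ h G)
    (π : Equiv.Perm (Option (Fin N))) :
    16 ≤ Nat.card {z : Word N // ∀ x ∈ puncture (permute π G), x + z ∈ puncture (permute π G)} := by
  have hqs := surjective_of_card_fiber hk hq
  obtain ⟨s, p, hG⟩ := hG
  have h16 : Nat.card (ZMod 2 × ZMod 2 → ZMod 2) = 16 := by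
    simp
  rw [← h16]
  refine card_le_card_translations
    (φ := fun u => (u ∘ fun i => (κ i, h i)) ∘ π.symm) ?_ ?_ ?_
  · exact π.symm.surjective.injective_comp_right.comp hqs.injective_comp_right
  · intro u
    have h1 := Equiv.sum_comp π.symm (u ∘ fun i => (κ i, h i))
    have h2 := sum_mul_colSum (fun i => (κ i, h i)) u (fun _ => 1)
    simp only [colSum, Finset.sum_const, hq, nsmul_eq_mul, mul_one,
      (ZMod.natCast_eq_zero_iff_even).2 hke, mul_zero] at h2
    exact h1.trans h2.symm
  · intro u x hx
    have := hG.flip_split ht u _ hx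
    simpa [permute, Function.comp_assoc, Pi.add_comp] using this

lemma card_le_card_quot {N : ℕ} (hN : 4 ≤ N) (R : Set {C : Set (Word N) // Perfect1 C})
    (h16 : ∀ C ∈ R, 16 ≤ Nat.card {z : Word N // ∀ x ∈ C.1, x + z ∈ C.1}) :
    Nat.card R ≤ N.factorial * 2 ^ (N - 4) * Nat.card (Quot (codeEquiv N)) := by
  refine (card_mul_le_of_fiber (fun C : R => Quot.mk (codeEquiv N) C.1) (N.factorial * 2 ^ (N - 4))
    fun b => ?_).trans (Nat.mul_le_mul_left _
      (Nat.card_le_card_of_injective _ Subtype.val_injective))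
  rcases isEmpty_or_nonempty {C : R // Quot.mk (codeEquiv N) C.1 = b} with h | ⟨⟨C₀, h₀⟩⟩
  · simp
  have hC : ∀ C : {C : R // Quot.mk (codeEquiv N) C.1 = b}, codeEquiv N C₀.1 C.1.1 := fun C =>
    (codeEquiv_equivalence N).eqvGen_iff.1 (Quot.eqvGen_exact (h₀.trans C.2.symm))
  have hle : Nat.card {C : R // Quot.mk (codeEquiv N) C.1 = b} ≤
      Nat.card {D : Set (Word N) // ∃ g, IsIsometry g ∧ D = g '' C₀.1.1} :=
    Nat.card_le_card_of_injective (fun C => ⟨C.1.1.1, hC C⟩) fun C C' h =>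
      Subtype.ext (Subtype.ext (Subtype.ext (Subtype.mk.inj h)))
  have h1 := (Nat.mul_le_mul hle (h16 C₀.1 C₀.2)).trans (card_images_mul_le C₀.1.1)
  have h2 : 2 ^ N = 2 ^ (N - 4) * 16 := by
    rw [show (16 : ℕ) = 2 ^ 4 by norm_num, ← pow_add, Nat.sub_add_cancel hN]
  rw [h2, ← mul_assoc] at h1
  exact Nat.le_of_mul_le_mul_right h1 (by norm_num)

lemma exists_fibers_card {I Q : Type} [Fintype I] [Fintype Q] [DecidableEq Q] {k : ℕ}
    (h : Fintype.card I = Fintype.card Q * k) : ∃ q : I → Q, ∀ b, #{i | q i = b} = k := by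
  obtain ⟨e⟩ := Fintype.card_eq.1
    (h.trans (show _ = Fintype.card (Q × Fin k) by simp))
  refine ⟨Prod.fst ∘ e, fun b => ?_⟩
  rw [← Fintype.card_subtype, Fintype.card_congr (e.subtypeEquiv
    (p := fun i => (Prod.fst ∘ e) i = b) (q := fun z => z.1 = b) fun i => Iff.rfl)]
  rw [Fintype.card_subtype, show ({z : Q × Fin k | z.1 = b} : Finset _) = {b} ×ˢ univ by
    ext z; simp [Prod.ext_iff, eq_comm]]
  simp

/-- Lower bound for the number of classes of perfect codes. -/
theorem factorial_mul_goodCount_le {N s : ℕ} (hs : 2 ≤ s) (hN : N + 1 = 4 * 2 ^ s) :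
    (N + 1).factorial * goodCount s 2 ≤ 6 * (2 ^ s).factorial ^ 4 *
      (N.factorial * 2 ^ (N - 4) * Nat.card (Quot (codeEquiv N))) := by
  classical
  have hk : 2 ^ s ≠ 0 := by positivity
  have hke : Even (2 ^ s) := (Nat.even_pow.2 ⟨even_two, by omega⟩)
  have h4 : 4 ≤ 2 ^ s := Nat.pow_le_pow_right (n := 2) two_pos hs
  obtain ⟨q, hq⟩ : ∃ q : Option (Fin N) → ZMod 2 × ZMod 2, ∀ b, #{i | q i = b} = 2 ^ s :=
    exists_fibers_card (by simpa using hN)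
  let κ i := (q i).1
  let h i := (q i).2
  change ∀ b, #{i | (κ i, h i) = b} = 2 ^ s at hq
  let Ψ : Equiv.Perm (Option (Fin N)) × {G // IsFamily (s + 1) κ h G} →
      {C : Set (Word N) // Perfect1 C} := fun z =>
    ⟨puncture (permute z.1 z.2.1),
      z.2.2.elim fun _ h => h.elim fun _ h => (h.isExtended.permute z.1).perfect1_puncture⟩
  have h1 := card_mul_le_of_fiber Ψ (24 * (2 ^ s).factorial ^ 4) fun C => by
    simp only [Ψ, Subtype.ext_iff]
    exact card_family_mul_le hk hq
  have h2 := card_le_card_quot (by omega) (Set.range Ψ) (by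
    rintro _ ⟨z, rfl⟩
    exact z.2.2.sixteen_le (by omega) hk hke hq z.1)
  have h3 := four_mul_goodCount_le rfl hq
  have hcard : Nat.card (Equiv.Perm (Option (Fin N))) = (N + 1).factorial := by
    simp [Fintype.card_perm]
  rw [Nat.card_prod, hcard] at h1
  have h5 := (Nat.mul_le_mul_left _ h3).trans (h1.trans (Nat.mul_le_mul_left _ h2))
  linarith

end Family

section Formula

lemma splitCount_eq_Dfac (m t : ℕ) : splitCount t (2 ^ (m - t)) = Dfac m t := rfl

lemma goodCount_eq_prod (m s : ℕ) (hs : s + 1 ≤ m) :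
    goodCount s (2 ^ (m - (s + 1))) = ∏ t ∈ Finset.Icc 1 s,
      (Dfac m t ^ Wfac m (t + 1) - Dfac m t * Wfac m (t + 1)) ^
        ∏ i ∈ Finset.Icc (t + 2) (s + 1), Wfac m i := by
  induction s with
  | zero => simp [goodCount]
  | succ s ih =>
    have h2 : 2 * 2 ^ (m - (s + 1 + 1)) = 2 ^ (m - (s + 1)) := by
      rw [← pow_succ']
      congr 1
      omega
    rw [goodCount, h2, ih (by omega), splitCount_eq_Dfac,
      Finset.prod_Icc_succ_top (by omega : 1 ≤ s + 1),
      Finset.Icc_eq_empty (by omega : ¬ s + 1 + 2 ≤ s + 1 + 1), Finset.prod_empty, pow_one,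
      mul_comm, ← Finset.prod_pow]
    refine congrArg₂ _ (Finset.prod_congr rfl fun t ht => ?_) rfl
    rw [Finset.prod_Icc_succ_top (b := s + 1) (by have := (Finset.mem_Icc.1 ht).2; omega),
      pow_mul]
    rfl

end Formula

end PerfectCode

/-- the number of equivalence classes of 1-perfect binary codes of length
n-1 under the isometry group of F^{n-1} is at least K/((n-1)!·2^{n-5}). -/
theorem stmt_18 (m : ℕ) (hm : 4 ≤ m) :
    Nat.card (Quot (codeEquiv (2 ^ m - 1))) *
        (Nat.factorial (2 ^ m - 1) * 2 ^ (2 ^ m - 5)) ≥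
      (Nat.factorial (2 ^ m) / (6 * (Nat.factorial (2 ^ m / 4)) ^ 4)) *
        ∏ t ∈ Finset.Icc 1 (m - 2),
          ((Dfac m t) ^ (Wfac m (t + 1)) - (Dfac m t) * (Wfac m (t + 1))) ^
            (∏ i ∈ Finset.Icc (t + 2) (m - 1), Wfac m i) := by
  obtain ⟨s, rfl⟩ : ∃ s, m = s + 2 := ⟨m - 2, by omega⟩
  have hp : 2 ^ (s + 2) = 4 * 2 ^ s := by ring
  have hpos : 4 ≤ 2 ^ s := Nat.pow_le_pow_right (n := 2) two_pos (by omega : 2 ≤ s)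
  have h1 := PerfectCode.factorial_mul_goodCount_le (N := 2 ^ (s + 2) - 1) (s := s) (by omega)
    (by omega)
  have h2 := PerfectCode.goodCount_eq_prod (s + 2) s (by omega)
  rw [show s + 2 - (s + 1) = 1 by omega, pow_one] at h2
  rw [show s + 2 - 2 = s by omega, show s + 2 - 1 = s + 1 by omega, ← h2,
    show 2 ^ (s + 2) / 4 = 2 ^ s by omega]
  rw [Nat.sub_add_cancel (by omega), show 2 ^ (s + 2) - 1 - 4 = 2 ^ (s + 2) - 5 by omega] at h1
  have h6 : 0 < 6 * (2 ^ s).factorial ^ 4 := by positivity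
  refine Nat.le_of_mul_le_mul_left ?_ h6
  rw [← mul_assoc]
  refine (Nat.mul_le_mul_right _ (Nat.mul_div_le _ _)).trans (h1.trans_eq ?_)
  ring
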